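/- arXiv:2010.14902 — 4 statements merged into one kernel-verified Lean document; each statement's English description precedes it below -/
import Mathlib

section
/- Let T be a tree on the vertex set {1,…,n} with n ≥ 2, and let l be any edge ordering of T. Then the product of the transpositions corresponding to the edges in l is an n-cycle, i.e., a cyclic permutation of {1,…,n} that moves every point. -/
/-- The transposition of `Sₙ` corresponding to an edge (an unordered pair) of a graph
on the vertex set `Fin n`. -/
def edgePerm {n : ℕ} (e : Sym2 (Fin n)) : Equiv.Perm (Fin n) :=
  Sym2.lift ⟨fun i j => Equiv.swap i j, fun i j => Equiv.swap_comm i j⟩ e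

/-- The product of the transpositions of a list of edges, the first edge applied first. -/
def listProd {n : ℕ} (l : List (Sym2 (Fin n))) : Equiv.Perm (Fin n) :=
  (l.map edgePerm).reverse.prod

/-- `l` is an edge ordering of the graph `T`: a duplicate-free list containing
exactly the edges of `T`. -/
def IsEdgeOrdering {n : ℕ} (T : SimpleGraph (Fin n)) (l : List (Sym2 (Fin n))) : Prop :=
  l.Nodup ∧ ∀ e, e ∈ l ↔ e ∈ T.edgeSet

theorem Equiv.Perm.sameCycle_of_forall_sameCycle_apply {α : Type*} [Finite α]
    {σ τ : Equiv.Perm α} (h : ∀ x, τ.SameCycle x (σ x)) {x y : α} (hxy : σ.SameCycle x y) :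
    τ.SameCycle x y := by
  obtain ⟨k, rfl⟩ := hxy.exists_nat_pow_eq
  clear hxy
  induction k with
  | zero => exact .refl _ _
  | succ k ih =>
    rw [pow_succ', Equiv.Perm.mul_apply]
    exact ih.trans (h _)

/-- Multiplying by a transposition of points in different cycles joins the two cycles. -/
theorem Equiv.Perm.sameCycle_mul_swap {α : Type*} [Finite α] [DecidableEq α]
    {σ : Equiv.Perm α} {a b : α} (hab : ¬ σ.SameCycle a b) :
    (σ * Equiv.swap a b).SameCycle a b := by
  have hper : ∃ k, 0 < k ∧ (σ ^ k) b = b :=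
    ⟨orderOf σ, orderOf_pos σ, by simp [pow_orderOf_eq_one]⟩
  classical
  obtain ⟨hpos, hfix⟩ := Nat.find_spec hper
  have key : ∀ j, j + 1 ≤ Nat.find hper →
      ((σ * Equiv.swap a b) ^ (j + 1)) a = (σ ^ (j + 1)) b := by
    intro j
    induction j with
    | zero => simp
    | succ j ih =>
      intro hj
      have hne_b : (σ ^ (j + 1)) b ≠ b := fun h =>
        Nat.find_min hper (m := j + 1) (by omega) ⟨by omega, h⟩
      have hne_a : (σ ^ (j + 1)) b ≠ a := fun h =>
        hab (Equiv.Perm.SameCycle.symm ⟨(j + 1 : ℕ), by simpa only [zpow_natCast] using h⟩)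
      rw [pow_succ', Equiv.Perm.mul_apply, ih (by omega), Equiv.Perm.mul_apply,
        Equiv.swap_apply_of_ne_of_ne hne_a hne_b, pow_succ' σ (j + 1), Equiv.Perm.mul_apply]
  refine ⟨(Nat.find hper : ℕ), ?_⟩
  have h := key (Nat.find hper - 1) (by omega)
  rw [Nat.sub_add_cancel hpos, hfix] at h
  rwa [zpow_natCast]

theorem Equiv.Perm.SameCycle.mul_swap {α : Type*} [Finite α] [DecidableEq α]
    {σ : Equiv.Perm α} {a b x y : α} (hab : ¬ σ.SameCycle a b) (hxy : σ.SameCycle x y) :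
    (σ * Equiv.swap a b).SameCycle x y := by
  refine Equiv.Perm.sameCycle_of_forall_sameCycle_apply (fun z => ?_) hxy
  have hj := Equiv.Perm.sameCycle_mul_swap hab
  have happ : ∀ w, (σ * Equiv.swap a b).SameCycle w (σ (Equiv.swap a b w)) := fun w =>
    ⟨1, by simp⟩
  by_cases ha : z = a
  · subst ha
    simpa using hj.trans (happ b)
  by_cases hb : z = b
  · subst hb
    simpa using hj.symm.trans (happ a)
  simpa [Equiv.swap_apply_of_ne_of_ne ha hb] using happ z

theorem listProd_cons {n : ℕ} (a b : Fin n) (l : List (Sym2 (Fin n))) :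
    listProd (s(a, b) :: l) = listProd l * Equiv.swap a b := by
  simp [listProd, edgePerm]

theorem reachable_listProd_apply {n : ℕ} (l : List (Sym2 (Fin n))) (x : Fin n) :
    (SimpleGraph.fromEdgeSet {e | e ∈ l}).Reachable x (listProd l x) := by
  induction l generalizing x with
  | nil => simp [listProd]
  | cons e l ih =>
    induction e with | h a b
    have hmono : SimpleGraph.fromEdgeSet {e | e ∈ l} ≤
        SimpleGraph.fromEdgeSet {e | e ∈ s(a, b) :: l} :=
      SimpleGraph.fromEdgeSet_mono fun e he => List.mem_cons_of_mem _ he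
    have hab : (SimpleGraph.fromEdgeSet {e | e ∈ s(a, b) :: l}).Reachable a b := by
      by_cases h : a = b
      · subst h; rfl
      · exact SimpleGraph.Adj.reachable (by simp [h])
    rw [listProd_cons, Equiv.Perm.mul_apply]
    refine SimpleGraph.Reachable.trans ?_ ((ih _).mono hmono)
    by_cases ha : x = a
    · subst ha; simpa using hab
    by_cases hb : x = b
    · subst hb; simpa using hab.symm
    rw [Equiv.swap_apply_of_ne_of_ne ha hb]

theorem reachable_of_sameCycle_listProd {n : ℕ} {l : List (Sym2 (Fin n))} {x y : Fin n}
    (h : (listProd l).SameCycle x y) :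
    (SimpleGraph.fromEdgeSet {e | e ∈ l}).Reachable x y := by
  obtain ⟨k, rfl⟩ := h.exists_nat_pow_eq
  clear h
  induction k with
  | zero => simp
  | succ k ih =>
    rw [pow_succ', Equiv.Perm.mul_apply]
    exact ih.trans (reachable_listProd_apply l _)

theorem sameCycle_listProd_of_mem {n : ℕ} {l : List (Sym2 (Fin n))} (hl : l.Nodup)
    (hdiag : ∀ e ∈ l, ¬ e.IsDiag)
    (hacyc : (SimpleGraph.fromEdgeSet {e | e ∈ l}).IsAcyclic) {x y : Fin n}
    (hxy : s(x, y) ∈ l) : (listProd l).SameCycle x y := by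
  induction l generalizing x y with
  | nil => simp at hxy
  | cons e l ih =>
    induction e with | h a b
    rw [List.nodup_cons] at hl
    have hne : a ≠ b := by simpa using hdiag s(a, b) (by simp)
    have hle : SimpleGraph.fromEdgeSet {e | e ∈ l} ≤
        (SimpleGraph.fromEdgeSet {e | e ∈ s(a, b) :: l}).deleteEdges {s(a, b)} := by
      intro u v huv
      rw [SimpleGraph.fromEdgeSet_adj] at huv
      rw [SimpleGraph.deleteEdges_adj, SimpleGraph.fromEdgeSet_adj]
      exact ⟨⟨List.mem_cons_of_mem _ huv.1, huv.2⟩, fun h => hl.1 (h ▸ huv.1)⟩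
    have hbridge : (SimpleGraph.fromEdgeSet {e | e ∈ s(a, b) :: l}).IsBridge s(a, b) :=
      SimpleGraph.isAcyclic_iff_forall_isBridge.1 hacyc (by simp [hne])
    have hab : ¬ (listProd l).SameCycle a b := fun h =>
      SimpleGraph.isBridge_iff.1 hbridge ((reachable_of_sameCycle_listProd h).mono hle)
    rw [listProd_cons]
    rcases List.mem_cons.1 hxy with h | h
    · have hj := Equiv.Perm.sameCycle_mul_swap hab
      rcases Sym2.eq_iff.1 h with ⟨rfl, rfl⟩ | ⟨rfl, rfl⟩
      · exact hj
      · exact hj.symm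
    · exact (ih hl.2 (fun e he => hdiag e (List.mem_cons_of_mem _ he))
        (hacyc.anti (hle.trans (SimpleGraph.deleteEdges_le _))) h).mul_swap hab

/-- the product of any edge ordering of a tree on `{1,…,n}` (`n ≥ 2`)
is an `n`-cycle, i.e. a cyclic permutation moving every point. -/
theorem stmt0 (n : ℕ) (hn : 2 ≤ n) (T : SimpleGraph (Fin n)) (hT : T.IsTree)
    (l : List (Sym2 (Fin n))) (hl : IsEdgeOrdering T l) :
    (listProd l).IsCycle ∧ ∀ x : Fin n, listProd l x ≠ x := by
  have hset : {e | e ∈ l} = T.edgeSet := Set.ext hl.2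
  have hadj : ∀ x y, T.Adj x y → (listProd l).SameCycle x y := fun x y h =>
    sameCycle_listProd_of_mem hl.1
      (fun e he => T.not_isDiag_of_mem_edgeSet ((hl.2 e).1 he))
      (by rw [hset, SimpleGraph.fromEdgeSet_edgeSet]; exact hT.isAcyclic)
      ((hl.2 _).2 h)
  have hall : ∀ x y, (listProd l).SameCycle x y := by
    intro x y
    obtain ⟨p⟩ := hT.connected.preconnected x y
    induction p with
    | nil => exact .refl _ _
    | cons h _ ih => exact (hadj _ _ h).trans ih
  have hmove : ∀ x, listProd l x ≠ x := by
    intro x hx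
    have : Nontrivial (Fin n) := Fin.nontrivial_iff_two_le.2 hn
    obtain ⟨y, hy⟩ := exists_ne x
    exact hy ((hall x y).eq_of_left hx).symm
  exact ⟨⟨⟨0, by omega⟩, hmove _, fun y _ => hall _ y⟩, hmove⟩
end

section
/- Let σ be any up-down permutation of {1,…,n}. Then there exists a finite sequence of transpositions t_1,…,t_m such that, setting σ_0 = σ and σ_k = t_k σ_{k−1} (left multiplication, which swaps the entries in two positions of the passive form), each σ_k is an up-down permutation, each t_k = (i,j) is acceptable for σ_{k−1} (i.e., |i−j| > 1 and the entries of σ_{k−1} in positions i and j differ by exactly 1), and σ_m is the canonical up-down permutation with passive form [1, n, 2, n−1, 3, n−2, …]. (Lemma 3.4.) -/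
/-- `σ` is an up-down permutation: its passive (one-line) form `[a₁,…,aₙ]`
(0-indexed: `aᵢ = σ i`) satisfies `a₁ < a₂ > a₃ < a₄ > ⋯`. -/
def UpDown {n : ℕ} (σ : Equiv.Perm (Fin n)) : Prop :=
  ∀ (i : ℕ) (h : i + 1 < n),
    (i % 2 = 0 → σ ⟨i, Nat.lt_of_succ_lt h⟩ < σ ⟨i + 1, h⟩) ∧
    (i % 2 = 1 → σ ⟨i + 1, h⟩ < σ ⟨i, Nat.lt_of_succ_lt h⟩)

/-- The transposition of positions `i, j` is acceptable for `σ` (with passive form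
`[a₁,…,aₙ]`) if `|i - j| > 1` but `|aᵢ - aⱼ| = 1`. -/
def Acceptable {n : ℕ} (σ : Equiv.Perm (Fin n)) (i j : Fin n) : Prop :=
  (i.val + 1 < j.val ∨ j.val + 1 < i.val) ∧
  ((σ i).val + 1 = (σ j).val ∨ (σ j).val + 1 = (σ i).val)

/-- An acceptable transposition preserves the up-down property. -/
theorem UpDown.mul_swap {n : ℕ} {σ : Equiv.Perm (Fin n)} (hσ : UpDown σ) {i j : Fin n}
    (h : Acceptable σ i j) : UpDown (σ * Equiv.swap i j) := by
  intro k hk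
  have hstep := hσ k hk
  obtain ⟨hij, hv⟩ := h
  have hne (a b : Fin n) (hab : a ≠ b) : (σ a).val ≠ (σ b).val := fun e =>
    hab (σ.injective (Fin.ext e))
  set a : Fin n := ⟨k, Nat.lt_of_succ_lt hk⟩ with ha
  set b : Fin n := ⟨k + 1, hk⟩ with hb
  have hai := hne a i
  have haj := hne a j
  have hbi := hne b i
  have hbj := hne b j
  have hav : a.val = k := rfl
  have hbv : b.val = k + 1 := rfl
  simp only [Equiv.Perm.mul_apply, Equiv.swap_apply_def, Fin.lt_def] at hstep ⊢
  split_ifs <;> grind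

/-- If `σ ≠ τ`, some two entries of `σ` with consecutive values occur in the opposite order
in `τ`. -/
theorem exists_consecutive_inversion {n : ℕ} {σ τ : Equiv.Perm (Fin n)} (h : σ ≠ τ) :
    ∃ i j : Fin n, (σ i).val + 1 = (σ j).val ∧ τ j < τ i := by
  by_contra! hno
  have hmono : StrictMono (fun v => τ (σ.symm v)) := by
    obtain _ | n := n
    · exact fun a => a.elim0
    · refine Fin.strictMono_iff_lt_succ.2 fun v => ?_
      refine lt_of_le_of_ne (hno _ _ (by simp)) fun e => ?_
      have := σ.symm.injective (τ.injective e)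
      simp [Fin.ext_iff] at this
  have hid : (fun v => τ (σ.symm v)) = id :=
    (hmono.range_inj strictMono_id).1 <| by
      rw [Set.range_id]
      exact (τ.surjective.comp σ.symm.surjective).range_eq
  exact h (Equiv.ext fun i => by simpa using (congrFun hid (σ i)).symm)

/-- Swapping two consecutive entries of `σ` that `τ` orders oppositely decreases the weight
`∑ x, σ x * (n - τ x)`. -/
theorem weight_mul_swap_lt {n : ℕ} {σ τ : Equiv.Perm (Fin n)} {i j : Fin n}
    (hv : (σ i).val + 1 = (σ j).val) (hτ : τ j < τ i) :
    ∑ x, ((σ * Equiv.swap i j) x).val * (n - (τ x).val) < ∑ x, (σ x).val * (n - (τ x).val) := by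
  have hij : i ≠ j := by rintro rfl; exact lt_irrefl _ hτ
  have hj : j ∈ Finset.univ.erase i := by simp [hij.symm]
  rw [← Finset.add_sum_erase _ _ (Finset.mem_univ i), ← Finset.add_sum_erase _ _ hj,
    ← Finset.add_sum_erase (a := i) _ (fun x => (σ x).val * (n - (τ x).val)) (Finset.mem_univ i),
    ← Finset.add_sum_erase _ (fun x => (σ x).val * (n - (τ x).val)) hj]
  have hrest : ∑ x ∈ (Finset.univ.erase i).erase j,
      ((σ * Equiv.swap i j) x).val * (n - (τ x).val) =
      ∑ x ∈ (Finset.univ.erase i).erase j, (σ x).val * (n - (τ x).val) := by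
    refine Finset.sum_congr rfl fun x hx => ?_
    simp only [Finset.mem_erase] at hx
    rw [Equiv.Perm.mul_apply, Equiv.swap_apply_of_ne_of_ne hx.2.1 hx.1]
  rw [hrest]
  simp only [Equiv.Perm.mul_apply, Equiv.swap_apply_left, Equiv.swap_apply_right, ← hv]
  have hlt : n - (τ i).val < n - (τ j).val := by
    have := (τ i).isLt
    have := Fin.lt_def.1 hτ
    omega
  nlinarith

/-- Any two up-down permutations are connected by acceptable transpositions. -/
theorem UpDown.exists_chain {n : ℕ} {σ τ : Equiv.Perm (Fin n)} (hσ : UpDown σ) (hτ : UpDown τ) :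
    ∃ (m : ℕ) (f : ℕ → Equiv.Perm (Fin n)),
      f 0 = σ ∧
      (∀ k ≤ m, UpDown (f k)) ∧
      (∀ k < m, ∃ i j : Fin n, Acceptable (f k) i j ∧ f (k + 1) = f k * Equiv.swap i j) ∧
      f m = τ := by
  induction hw : ∑ x, (σ x).val * (n - (τ x).val) using Nat.strong_induction_on generalizing σ with
  | _ w ih =>
    by_cases hστ : σ = τ
    · exact ⟨0, fun _ => σ, rfl, fun _ _ => hσ, by simp, hστ⟩
    obtain ⟨i, j, hv, hji⟩ := exists_consecutive_inversion hστ
    have hacc : Acceptable σ i j := by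
      refine ⟨?_, Or.inl hv⟩
      by_contra! hnear
      have hne : i.val ≠ j.val := fun e => by
        rw [Fin.ext e] at hv
        omega
      have hcases : j.val = i.val + 1 ∨ i.val = j.val + 1 := by omega
      have hji' := Fin.lt_def.1 hji
      obtain ⟨a, ha⟩ := i
      obtain ⟨b, hb⟩ := j
      simp only at hcases
      rcases hcases with rfl | rfl
      · have h1 := hσ a hb
        have h2 := hτ a hb
        simp only [Fin.lt_def] at h1 h2
        omega
      · have h1 := hσ b ha
        have h2 := hτ b ha
        simp only [Fin.lt_def] at h1 h2
        omega
    obtain ⟨m, f, hf0, hf, hstep, hfm⟩ :=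
      ih _ (hw ▸ weight_mul_swap_lt hv hji) (hσ.mul_swap hacc) rfl
    refine ⟨m + 1, fun k => Nat.casesOn k σ f, rfl, ?_, ?_, hfm⟩
    · rintro (_ | k) hk
      · exact hσ
      · exact hf k (by omega)
    · rintro (_ | k) hk
      · exact ⟨i, j, hacc, hf0⟩
      · exact hstep k (by omega)

/-- The canonical up-down permutation exists. -/
theorem exists_canonical_upDown (n : ℕ) : ∃ τ : Equiv.Perm (Fin n), UpDown τ ∧
    ∀ i : Fin n, (τ i).val = if i.val % 2 = 0 then i.val / 2 else n - 1 - i.val / 2 := by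
  let g : Fin n → Fin n := fun i =>
    ⟨if i.val % 2 = 0 then i.val / 2 else n - 1 - i.val / 2, by
      have := i.isLt
      split_ifs <;> omega⟩
  have hg : Function.Injective g := by
    intro a b hab
    have hab' := Fin.ext_iff.1 hab
    simp only [g] at hab'
    have := a.isLt
    have := b.isLt
    apply Fin.ext
    split_ifs at hab' <;> omega
  refine ⟨Equiv.ofBijective g (Finite.injective_iff_bijective.1 hg), fun i hi => ?_, fun i => rfl⟩
  simp only [Equiv.ofBijective_apply, Fin.lt_def, g]
  constructor <;> intro hpar <;> split_ifs <;> omega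

/-- Lemma 3.4: from any up-down permutation one can reach the canonical
up-down permutation (passive form `[1, n, 2, n-1, 3, …]`, 0-indexed
`i ↦ if i even then i/2 else n-1-i/2`) by successively swapping the entries in two
positions forming an acceptable transposition, staying up-down at each step. -/
theorem stmt8 (n : ℕ) (σ : Equiv.Perm (Fin n)) (hσ : UpDown σ) :
    ∃ (m : ℕ) (f : ℕ → Equiv.Perm (Fin n)),
      f 0 = σ ∧
      (∀ k ≤ m, UpDown (f k)) ∧
      (∀ k < m, ∃ i j : Fin n, Acceptable (f k) i j ∧ f (k + 1) = f k * Equiv.swap i j) ∧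
      (∀ i : Fin n, (f m i).val = if i.val % 2 = 0 then i.val / 2 else n - 1 - i.val / 2) := by
  obtain ⟨τ, hτ, hcanon⟩ := exists_canonical_upDown n
  obtain ⟨m, f, hf0, hf, hstep, hfm⟩ := hσ.exists_chain hτ
  exact ⟨m, f, hf0, hf, hstep, fun i => hfm ▸ hcanon i⟩
end

section
/- Consider the path on n+1 vertices labeled 1,…,n+1 consecutively, with edges e_1,…,e_n where e_i is the transposition (i, i+1). For a permutation σ of {1,…,n}, the product e_{σ(1)} e_{σ(2)} ⋯ e_{σ(n)} (composed in this order, with e_{σ(1)} applied first) equals the canonical cycle—the (n+1)-cycle whose cycle notation lists the odd elements of {1,…,n+1} in increasing order followed by the even elements in decreasing order, (1,3,5,…,6,4,2)—if and only if the inverse permutation σ^{−1} is an up-down permutation of {1,…,n}. (Theorem 3.5.) -/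
/-- The left endpoint of the `i`-th edge of the path on `n` vertices. -/
def edgeIdx1 {n : ℕ} (i : Fin (n - 1)) : Fin n :=
  ⟨i.val, lt_of_lt_of_le i.isLt (Nat.sub_le n 1)⟩

/-- The right endpoint of the `i`-th edge of the path on `n` vertices. -/
def edgeIdx2 {n : ℕ} (i : Fin (n - 1)) : Fin n :=
  ⟨i.val + 1, Nat.add_lt_of_lt_sub i.isLt⟩

/-- The `i`-th edge `{i, i+1}` of the path on `n` vertices `0, 1, …, n-1`. -/
def pathEdge {n : ℕ} (i : Fin (n - 1)) : Sym2 (Fin n) := s(edgeIdx1 i, edgeIdx2 i)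

/-- `l` is an edge ordering of the path on `n` vertices: a duplicate-free list
containing exactly the edges of the path. -/
def IsPathOrdering (n : ℕ) (l : List (Sym2 (Fin n))) : Prop :=
  l.Nodup ∧ ∀ e, e ∈ l ↔ ∃ i : Fin (n - 1), e = pathEdge i

/-- The multiplicity of the permutation `c` for the path on `n` vertices:
the number of edge orderings whose product is `c`. -/
noncomputable def pathMult (n : ℕ) (c : Equiv.Perm (Fin n)) : ℕ :=
  {l : List (Sym2 (Fin n)) | IsPathOrdering n l ∧ listProd l = c}.ncard

/-- `x` is the trajectory of a token on the path `0, 1, 2, …`, where the edge `{j, j+1}` swaps its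
endpoints at time `p j`, observed up to time `n`. -/
def IsTrajectory (n : ℕ) (p x : ℕ → ℕ) : Prop :=
  ∀ k < n, x (k + 1) =
    if p (x k) = k then x k + 1 else if 0 < x k ∧ p (x k - 1) = k then x k - 1 else x k

namespace IsTrajectory

variable {n : ℕ} {p x : ℕ → ℕ}

theorem le_of_left_first (h : IsTrajectory n p x) {i : ℕ} (h0 : x 0 = i + 1) (hi : p i < n)
    (hlt : p i < p (i + 1)) : x n ≤ i := by
  have key : ∀ k ≤ n, (k ≤ p i → x k = i + 1) ∧ (p i < k → x k ≤ i) := by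
    intro k
    induction k with
    | zero => grind
    | succ k ih =>
      intro hk
      have := h k hk
      grind
  exact (key n le_rfl).2 hi

theorem add_two_le_of_right_first (h : IsTrajectory n p x) {i : ℕ} (h0 : x 0 = i + 1)
    (hi : p (i + 1) < n) (hlt : p (i + 1) < p i) : i + 2 ≤ x n := by
  have key : ∀ k ≤ n, (k ≤ p (i + 1) → x k = i + 1) ∧ (p (i + 1) < k → i + 2 ≤ x k) := by
    intro k
    induction k with
    | zero => grind
    | succ k ih =>
      intro hk
      have := h k hk
      grind
  exact (key n le_rfl).2 hi

theorem eq_of_moves_right (h : IsTrajectory n p x) {v : ℕ} (h0 : x 0 = v)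
    (hl : 0 < v → p v < p (v - 1)) (hm : p v < p (v + 1))
    (hr : p (v + 1) < n → p (v + 2) < p (v + 1) ∨ n ≤ p (v + 2)) :
    x n = v + (if p v < n then 1 else 0) + (if p (v + 1) < n then 1 else 0) := by
  have key : ∀ k ≤ n,
      x k = v + (if p v < k then 1 else 0) + (if p (v + 1) < k then 1 else 0) := by
    intro k
    induction k with
    | zero => grind
    | succ k ih =>
      intro hk
      have := h k hk
      have := ih (by omega)
      rcases lt_trichotomy (p v) k with h1 | h1 | h1 <;>
        rcases lt_trichotomy (p (v + 1)) k with h2 | h2 | h2 <;> grind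
  exact key n le_rfl

theorem eq_of_moves_left_twice (h : IsTrajectory n p x) {v : ℕ} (h0 : x 0 = v + 2)
    (hr : p (v + 1) < p (v + 2)) (hm : p (v + 1) < p v) (hn : p v < n)
    (hl : 0 < v → p (v - 1) < p v) : x n = v := by
  have key : ∀ k ≤ n,
      x k + (if p (v + 1) < k then 1 else 0) + (if p v < k then 1 else 0) = v + 2 := by
    intro k
    induction k with
    | zero => grind
    | succ k ih =>
      intro hk
      have := h k hk
      have := ih (by omega)
      rcases lt_trichotomy (p v) k with h1 | h1 | h1 <;>
        rcases lt_trichotomy (p (v + 1)) k with h2 | h2 | h2 <;> grind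
  have := key n le_rfl
  grind

theorem eq_of_moves_left_once (h : IsTrajectory n p x) {v : ℕ} (h0 : x 0 = v + 1)
    (hr : p v < p (v + 1)) (hn : p v < n) (hl : 0 < v → p (v - 1) < p v) : x n = v := by
  have key : ∀ k ≤ n, x k + (if p v < k then 1 else 0) = v + 1 := by
    intro k
    induction k with
    | zero => grind
    | succ k ih =>
      intro hk
      have := h k hk
      have := ih (by omega)
      rcases lt_trichotomy (p v) k with h1 | h1 | h1 <;> grind
  have := key n le_rfl
  grind

end IsTrajectory

theorem edgePerm_pathEdge_val {n : ℕ} (j : Fin (n - 1)) (w : Fin n) :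
    (edgePerm (pathEdge j) w).val =
      if w.val = j.val then w.val + 1 else if w.val = j.val + 1 then w.val - 1 else w.val := by
  change (Equiv.swap (edgeIdx1 j) (edgeIdx2 j) w).val = _
  rw [Equiv.swap_apply_def]
  simp only [Fin.ext_iff, edgeIdx1, edgeIdx2]
  split_ifs <;> simp_all

theorem listProd_append_singleton {n : ℕ} (l : List (Sym2 (Fin n))) (e : Sym2 (Fin n))
    (v : Fin n) : listProd (l ++ [e]) v = edgePerm e (listProd l v) := by
  simp [listProd]

/-- The time at which the edge `{j, j+1}` is used in the edge ordering given by `σ`; edges outside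
the path are assigned the time `n`, at which everything is over. -/
def edgeTime {n : ℕ} (σ : Equiv.Perm (Fin n)) (j : ℕ) : ℕ :=
  if h : j < n then (σ⁻¹ ⟨j, h⟩).val else n

theorem edgeTime_of_lt {n : ℕ} (σ : Equiv.Perm (Fin n)) {j : ℕ} (h : j < n) :
    edgeTime σ j = (σ⁻¹ ⟨j, h⟩).val := dif_pos h

theorem edgeTime_lt {n : ℕ} (σ : Equiv.Perm (Fin n)) {j : ℕ} (h : j < n) : edgeTime σ j < n := by
  rw [edgeTime_of_lt σ h]
  exact Fin.isLt _

theorem edgeTime_of_ge {n : ℕ} (σ : Equiv.Perm (Fin n)) {j : ℕ} (h : n ≤ j) :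
    edgeTime σ j = n := dif_neg (by omega)

theorem edgeTime_eq_iff {n : ℕ} (σ : Equiv.Perm (Fin n)) (j : ℕ) (k : Fin n) :
    edgeTime σ j = k.val ↔ j = (σ k).val := by
  by_cases h : j < n
  · rw [edgeTime_of_lt σ h, ← Fin.ext_iff, Equiv.Perm.inv_eq_iff_eq, Fin.ext_iff]
  · rw [edgeTime_of_ge σ (by omega)]
    have := (σ k).isLt
    have := k.isLt
    omega

theorem exists_isTrajectory {n : ℕ} (σ : Equiv.Perm (Fin n)) (v : Fin (n + 1)) :
    ∃ x : ℕ → ℕ, IsTrajectory n (edgeTime σ) x ∧ x 0 = v.val ∧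
      x n = (listProd (List.ofFn fun k : Fin n => pathEdge (n := n + 1) (σ k)) v).val := by
  set l := List.ofFn fun k : Fin n => pathEdge (n := n + 1) (σ k) with hl
  have hlen : l.length = n := by simp [hl]
  refine ⟨fun k => (listProd (l.take k) v).val, fun k hk => ?_, by simp [listProd], ?_⟩
  · have hget : l[k]'(by omega) = pathEdge (n := n + 1) (σ ⟨k, hk⟩) := by simp [hl]
    have hstep : l.take (k + 1) = l.take k ++ [pathEdge (n := n + 1) (σ ⟨k, hk⟩)] := by
      rw [List.take_succ_eq_append_getElem (by omega), hget]
    have h1 := edgeTime_eq_iff σ (listProd (l.take k) v).val ⟨k, hk⟩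
    have h2 := edgeTime_eq_iff σ ((listProd (l.take k) v).val - 1) ⟨k, hk⟩
    simp only at h1 h2
    simp only [hstep, listProd_append_singleton, edgePerm_pathEdge_val, h1, h2]
    grind
  · simp [← hlen]

theorem upDown_inv_iff {n : ℕ} (σ : Equiv.Perm (Fin n)) :
    UpDown σ⁻¹ ↔ ∀ i, i + 1 < n →
      (i % 2 = 0 → edgeTime σ i < edgeTime σ (i + 1)) ∧
      (i % 2 = 1 → edgeTime σ (i + 1) < edgeTime σ i) := by
  refine forall₂_congr fun i h => ?_
  rw [edgeTime_of_lt σ h, edgeTime_of_lt σ (Nat.lt_of_succ_lt h)]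
  rfl

theorem edgeTime_ne_succ {n : ℕ} (σ : Equiv.Perm (Fin n)) {i : ℕ} (h : i + 1 < n) :
    edgeTime σ i ≠ edgeTime σ (i + 1) := by
  rw [edgeTime_of_lt σ h, edgeTime_of_lt σ (Nat.lt_of_succ_lt h)]
  simp [← Fin.ext_iff]

/-- Theorem 3.5: for the path on `n+1` vertices (0-indexed here:
vertices `0,…,n`, edges `eᵢ = {i, i+1}` for `i = 0,…,n-1`), the product
`e_{σ(1)} ⋯ e_{σ(n)}` (first edge applied first) equals the canonical cycle `c`
(listing the even 0-indexed vertices in increasing order followed by the odd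
vertices in decreasing order) iff `σ⁻¹` is an up-down permutation. -/
theorem stmt9 (n : ℕ) (hn : 1 ≤ n) (c : Equiv.Perm (Fin (n + 1)))
    (hc : ∀ v : Fin (n + 1), (c v).val =
      if v.val % 2 = 0 then
        (if v.val + 2 ≤ n then v.val + 2 else if n % 2 = 1 then n else n - 1)
      else (if v.val = 1 then 0 else v.val - 2))
    (σ : Equiv.Perm (Fin n)) :
    listProd (List.ofFn fun k : Fin n => pathEdge (n := n + 1) (σ k)) = c
      ↔ UpDown σ⁻¹ := by
  rw [upDown_inv_iff]
  constructor
  · rintro hprod i hi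
    obtain ⟨x, hx, hx0, hxn⟩ := exists_isTrajectory σ ⟨i + 1, by omega⟩
    rw [hprod, hc] at hxn
    simp only at hx0 hxn
    have hne := edgeTime_ne_succ σ hi
    have hl := hx.le_of_left_first hx0 (edgeTime_lt σ (by omega))
    have hr := hx.add_two_le_of_right_first hx0 (edgeTime_lt σ hi)
    constructor <;> intro hpar <;> split_ifs at hxn <;> omega
  · intro hud
    ext v
    obtain ⟨x, hx, hx0, hxn⟩ := exists_isTrajectory σ v
    rw [← hxn, hc]
    obtain ⟨v, hv⟩ := v
    simp only at hx0 ⊢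
    have hlt : ∀ j, j < n → edgeTime σ j < n := fun j => edgeTime_lt σ
    have hge : ∀ j, n ≤ j → edgeTime σ j = n := fun j => edgeTime_of_ge σ
    generalize edgeTime σ = p at *
    have hup : ∀ i, i < n → i % 2 = 0 → p i < p (i + 1) := fun i hi hpar => by
      rcases Nat.lt_or_ge (i + 1) n with h | h
      · exact (hud i h).1 hpar
      · rw [hge _ h]
        exact hlt i hi
    have hdown : ∀ i, i + 1 < n → i % 2 = 1 → p (i + 1) < p i := fun i hi => (hud i hi).2
    rcases Nat.mod_two_eq_zero_or_one v with hpar | hpar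
    · rcases Nat.lt_or_ge v n with hvn | hvn
      · have hl : 0 < v → p v < p (v - 1) := fun hpos => by
          have := hdown (v - 1) (by omega) (by omega)
          rwa [Nat.sub_add_cancel hpos] at this
        have hr : p (v + 1) < n → p (v + 2) < p (v + 1) ∨ n ≤ p (v + 2) := fun _ => by
          rcases Nat.lt_or_ge (v + 2) n with h | h
          · exact Or.inl (hdown (v + 1) h (by omega))
          · exact Or.inr (hge _ h).ge
        have hxv := hx.eq_of_moves_right hx0 hl (hup v hvn hpar) hr
        have := hlt v hvn
        have := hlt (v + 1)
        have := hge (v + 1)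
        split_ifs at hxv ⊢ <;> omega
      · obtain rfl : v = n := by omega
        obtain ⟨w, rfl⟩ : ∃ w, v = w + 1 := ⟨v - 1, by omega⟩
        have hl : 0 < w → p (w - 1) < p w := fun hpos => by
          have := hup (w - 1) (by omega) (by omega)
          rwa [Nat.sub_add_cancel hpos] at this
        have := hx.eq_of_moves_left_once hx0 (by rw [hge _ le_rfl]; exact hlt w (by omega))
          (hlt w (by omega)) hl
        split_ifs <;> omega
    · have hl : ∀ w, v = w + 2 → 0 < w → p (w - 1) < p w := fun w hw hpos => by
        have := hup (w - 1) (by omega) (by omega)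
        rwa [Nat.sub_add_cancel hpos] at this
      rcases Nat.lt_or_ge 1 v with h1 | h1
      · obtain ⟨w, rfl⟩ : ∃ w, v = w + 2 := ⟨v - 2, by omega⟩
        have := hx.eq_of_moves_left_twice hx0 (hup (w + 1) (by omega) (by omega))
          (hdown w (by omega) (by omega)) (hlt w (by omega)) (hl w rfl)
        split_ifs <;> omega
      · obtain rfl : v = 1 := by omega
        have := hx.eq_of_moves_left_once hx0 (hup 0 (by omega) rfl) (hlt 0 (by omega)) (by simp)
        simpa using this
end

section
/- For the path on n+1 vertices labeled 1,…,n+1 consecutively, the number of edge orderings whose product is the canonical cycle (1,3,5,…,6,4,2) equals the number of up-down permutations of {1,…,n} (the Euler number E_n). -/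
/-- The image of the vertex `x` of the infinite path under the transposition `(i, i+1)`. -/
def pathStep (x i : ℕ) : ℕ := if x = i then i + 1 else if x = i + 1 then i else x

/-- In a list related pairwise by `EvenFirst`, of two adjacent edges the one with even index
precedes the one with odd index. -/
def EvenFirst (i j : ℕ) : Prop := (j = i + 1 → i % 2 = 0) ∧ (i = j + 1 → i % 2 = 0)

theorem foldl_pathStep_le {a x : ℕ} {l : List ℕ} (ha : a ∉ l) (hx : x ≤ a) :
    l.foldl pathStep x ≤ a := by
  induction l generalizing x with
  | nil => simpa
  | cons b l ih =>
    simp only [List.mem_cons, not_or] at ha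
    refine ih ha.2 ?_
    unfold pathStep
    grind

theorem lt_foldl_pathStep {a x : ℕ} {l : List ℕ} (ha : a ∉ l) (hx : a < x) :
    a < l.foldl pathStep x := by
  induction l generalizing x with
  | nil => simpa
  | cons b l ih =>
    simp only [List.mem_cons, not_or] at ha
    refine ih ha.2 ?_
    unfold pathStep
    grind

theorem foldl_pathStep_of_idxOf {v : ℕ} {l : List ℕ} (hl : l.Nodup) (h0 : v ∈ l)
    (h1 : v + 1 ∈ l) :
    (l.idxOf v < l.idxOf (v + 1) → l.foldl pathStep (v + 1) ≤ v) ∧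
    (l.idxOf (v + 1) < l.idxOf v → v + 1 < l.foldl pathStep (v + 1)) := by
  induction l with
  | nil => simp at h0
  | cons a l ih =>
    obtain ⟨hal, hl⟩ := List.nodup_cons.1 hl
    rw [List.foldl_cons]
    by_cases hav : a = v
    · subst hav
      refine ⟨fun _ => foldl_pathStep_le hal (by simp [pathStep]), fun h => ?_⟩
      simp at h
    by_cases hav' : a = v + 1
    · subst hav'
      refine ⟨fun h => ?_, fun _ => lt_foldl_pathStep hal (by simp [pathStep])⟩
      simp at h
    have hs : pathStep (v + 1) a = v + 1 := by unfold pathStep; grind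
    rw [hs, List.idxOf_cons_ne _ hav, List.idxOf_cons_ne _ hav']
    have := ih hl (by grind) (by grind)
    simpa using this

theorem foldl_pathStep_of_pairwise {l : List ℕ} (hl : l.Nodup) (hp : l.Pairwise EvenFirst)
    (v : ℕ) :
    l.foldl pathStep v =
      if v % 2 = 0 then
        (if v ∈ l then (if v + 1 ∈ l then v + 2 else v + 1)
          else if 1 ≤ v ∧ v - 1 ∈ l then v - 1 else v)
      else
        (if v - 1 ∈ l then (if 2 ≤ v ∧ v - 2 ∈ l then v - 2 else v - 1)
          else if v ∈ l then v + 1 else v) := by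
  induction l generalizing v with
  | nil => simp
  | cons a l ih =>
    obtain ⟨hal, hl⟩ := List.nodup_cons.1 hl
    obtain ⟨ha, hp⟩ := List.pairwise_cons.1 hp
    have up : a + 1 ∈ l → a % 2 = 0 := fun h => (ha _ h).1 rfl
    have down : 1 ≤ a → a - 1 ∈ l → a % 2 = 0 := fun h0 h => (ha _ h).2 (by omega)
    rw [List.foldl_cons, ih hl hp]
    clear ih ha hp hl
    by_cases h : v = a
    · subst h
      have : pathStep v v = v + 1 := by simp [pathStep]
      rw [this]
      rcases Nat.mod_two_eq_zero_or_one v with h2 | h2 <;>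
        simp only [List.mem_cons] <;> grind
    by_cases h' : v = a + 1
    · subst h'
      have : pathStep (a + 1) a = a := by simp [pathStep]
      rw [this]
      rcases Nat.mod_two_eq_zero_or_one a with h2 | h2 <;>
        simp only [List.mem_cons] <;> grind
    have : pathStep v a = v := by unfold pathStep; grind
    rw [this]
    simp only [List.mem_cons]
    rcases Nat.mod_two_eq_zero_or_one v with h2 | h2 <;> grind

theorem pathEdge_injective (n : ℕ) : Function.Injective (pathEdge (n := n)) := by
  intro i j h
  simp only [pathEdge, Sym2.eq_iff, edgeIdx1, edgeIdx2, Fin.mk.injEq] at h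
  ext
  omega

theorem edgePerm_pathEdge_val_s10 {n : ℕ} (i : Fin (n - 1)) (x : Fin n) :
    (edgePerm (pathEdge i) x).val = pathStep x i := by
  simp only [edgePerm, pathEdge, Sym2.lift_mk, Equiv.swap_apply_def, pathStep, Fin.ext_iff,
    edgeIdx1, edgeIdx2]
  split_ifs <;> rfl

theorem listProd_map_pathEdge_val {n : ℕ} (l : List (Fin (n - 1))) (x : Fin n) :
    (listProd (l.map pathEdge) x).val = (l.map Fin.val).foldl pathStep x := by
  induction l generalizing x with
  | nil => simp [listProd]
  | cons a l ih =>
    have : listProd ((a :: l).map pathEdge) x =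
        listProd (l.map pathEdge) (edgePerm (pathEdge a) x) := by
      simp [listProd]
    rw [this, ih, edgePerm_pathEdge_val_s10, List.map_cons, List.foldl_cons]

/-- The edge ordering in which the `i`-th edge of the path occurs at position `σ i`. -/
def permOrdering {n : ℕ} (σ : Equiv.Perm (Fin n)) : List (Sym2 (Fin (n + 1))) :=
  (List.ofFn σ.symm).map (pathEdge (n := n + 1))

theorem permOrdering_injective (n : ℕ) : Function.Injective (permOrdering (n := n)) := by
  intro σ τ h
  have h := List.ofFn_injective ((pathEdge_injective (n + 1)).list_map h)
  exact Equiv.symm_bijective.injective (DFunLike.coe_injective h)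

theorem isPathOrdering_iff_mem_range {n : ℕ} (l : List (Sym2 (Fin (n + 1)))) :
    IsPathOrdering (n + 1) l ↔ l ∈ Set.range (permOrdering (n := n)) := by
  constructor
  · rintro ⟨hnd, hmem⟩
    obtain ⟨m, rfl⟩ : l ∈ Set.range (List.map (pathEdge (n := n + 1))) := by
      rw [Set.range_list_map]
      intro e he
      obtain ⟨i, rfl⟩ := (hmem e).1 he
      exact ⟨i, rfl⟩
    have hm : m.Nodup := hnd.of_map
    have hall : ∀ i, i ∈ m := fun i => by
      have := (hmem (pathEdge i)).2 ⟨i, rfl⟩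
      rwa [List.mem_map_of_injective (pathEdge_injective _)] at this
    have hlen : n = m.length := by
      have := Fintype.card_congr (hm.getEquivOfForallMemList m hall)
      simpa using this.symm
    refine ⟨((finCongr hlen).trans (hm.getEquivOfForallMemList m hall)).symm, ?_⟩
    unfold permOrdering
    congr 1
    apply List.ext_getElem
    · simpa using hlen
    · intro k h1 h2
      simp
  · rintro ⟨σ, rfl⟩
    refine ⟨(List.nodup_ofFn.2 σ.symm.injective).map (pathEdge_injective _), fun e => ?_⟩
    simp only [permOrdering, List.mem_map, List.mem_ofFn]
    constructor
    · rintro ⟨i, -, rfl⟩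
      exact ⟨i, rfl⟩
    · rintro ⟨i, rfl⟩
      exact ⟨i, σ.symm.surjective i, rfl⟩

theorem idxOf_map_val_ofFn_symm {n : ℕ} (σ : Equiv.Perm (Fin n)) (i : Fin n) :
    ((List.ofFn σ.symm).map Fin.val).idxOf i.val = (σ i).val := by
  have hnd : ((List.ofFn σ.symm).map Fin.val).Nodup :=
    (List.nodup_ofFn.2 σ.symm.injective).map Fin.val_injective
  have := hnd.idxOf_getElem (σ i).val (by simp)
  simpa using this

theorem mem_map_val_ofFn_symm {n : ℕ} (σ : Equiv.Perm (Fin n)) (k : ℕ) :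
    k ∈ (List.ofFn σ.symm).map Fin.val ↔ k < n := by
  simp only [List.mem_map, List.mem_ofFn]
  constructor
  · rintro ⟨i, -, rfl⟩
    exact i.isLt
  · exact fun h => ⟨⟨k, h⟩, σ.symm.surjective _, rfl⟩

theorem UpDown.pairwise_evenFirst {n : ℕ} {σ : Equiv.Perm (Fin n)} (h : UpDown σ) :
    ((List.ofFn σ.symm).map Fin.val).Pairwise EvenFirst := by
  rw [List.pairwise_map, List.pairwise_ofFn]
  intro a b hab
  obtain ⟨i, rfl⟩ := σ.surjective a
  obtain ⟨j, rfl⟩ := σ.surjective b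
  simp only [Equiv.symm_apply_apply]
  constructor
  · intro hij
    have hlt : i.val + 1 < n := hij ▸ j.isLt
    have hj : j = ⟨i.val + 1, hlt⟩ := Fin.ext hij
    subst hj
    by_contra hi
    exact lt_asymm hab ((h i hlt).2 (by omega))
  · intro hij
    have hlt : j.val + 1 < n := hij ▸ i.isLt
    have hi : i = ⟨j.val + 1, hlt⟩ := Fin.ext hij
    subst hi
    by_contra hj
    simp only at hj
    exact lt_asymm hab ((h j hlt).1 (by omega))

theorem listProd_permOrdering_eq_iff {n : ℕ} (hn : 1 ≤ n) {c : Equiv.Perm (Fin (n + 1))}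
    (hc : ∀ v : Fin (n + 1), (c v).val =
      if v.val % 2 = 0 then
        (if v.val + 2 ≤ n then v.val + 2 else if n % 2 = 1 then n else n - 1)
      else (if v.val = 1 then 0 else v.val - 2))
    (σ : Equiv.Perm (Fin n)) : listProd (permOrdering σ) = c ↔ UpDown σ := by
  have hnd : ((List.ofFn σ.symm).map Fin.val).Nodup :=
    (List.nodup_ofFn.2 σ.symm.injective).map Fin.val_injective
  have hval (x : Fin (n + 1)) : (listProd (permOrdering σ) x).val =
      ((List.ofFn σ.symm).map Fin.val).foldl pathStep x :=
    listProd_map_pathEdge_val (n := n + 1) _ x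
  constructor
  · rintro rfl i h
    have hcv := hc ⟨i + 1, by omega⟩
    rw [hval] at hcv
    have key := foldl_pathStep_of_idxOf hnd ((mem_map_val_ofFn_symm σ i).2 (by omega))
      ((mem_map_val_ofFn_symm σ (i + 1)).2 h)
    have h0 := idxOf_map_val_ofFn_symm σ ⟨i, by omega⟩
    have h1 := idxOf_map_val_ofFn_symm σ ⟨i + 1, h⟩
    have hne : (σ ⟨i, by omega⟩).val ≠ (σ ⟨i + 1, h⟩).val := by
      simp [Fin.val_inj]
    simp only at h0 h1 hcv
    rw [h0, h1] at key
    simp only [Fin.lt_def]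
    constructor <;> intro hi <;> split_ifs at hcv <;> omega
  · intro h
    ext x
    have hx := x.isLt
    rw [hval, hc, foldl_pathStep_of_pairwise hnd h.pairwise_evenFirst]
    simp only [mem_map_val_ofFn_symm]
    split_ifs <;> omega

/-- for the path on `n+1` vertices (0-indexed), the number of edge
orderings whose product is the canonical cycle `c` equals the number of up-down
permutations of an `n`-element set (the Euler number `Eₙ`). -/
theorem stmt10 (n : ℕ) (hn : 1 ≤ n) (c : Equiv.Perm (Fin (n + 1)))
    (hc : ∀ v : Fin (n + 1), (c v).val =
      if v.val % 2 = 0 then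
        (if v.val + 2 ≤ n then v.val + 2 else if n % 2 = 1 then n else n - 1)
      else (if v.val = 1 then 0 else v.val - 2)) :
    pathMult (n + 1) c = {σ : Equiv.Perm (Fin n) | UpDown σ}.ncard := by
  rw [← Set.ncard_image_of_injective _ (permOrdering_injective n), pathMult]
  congr 1
  ext l
  simp only [Set.mem_ofPred_eq, Set.mem_image, isPathOrdering_iff_mem_range, Set.mem_range]
  constructor
  · rintro ⟨⟨σ, rfl⟩, h⟩
    exact ⟨σ, (listProd_permOrdering_eq_iff hn hc σ).1 h, rfl⟩
  · rintro ⟨σ, h, rfl⟩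
    exact ⟨⟨σ, rfl⟩, (listProd_permOrdering_eq_iff hn hc σ).2 h⟩
end
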